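/- If G is a graph of order n ≥ 2, then 4 ≤ b_g(G) + b_g(complement of G) ≤ n + 2. -/

import Mathlib

namespace BurningGame

/-- One spreading phase: all neighbors of burned vertices become burned. -/
noncomputable def spread {V : Type*} [Fintype V] [DecidableEq V] (G : SimpleGraph V) (B : Finset V) : Finset V :=
  ((↑B : Set V) ∪ {v | ∃ u ∈ B, G.Adj u v}).toFinite.toFinset

/-- `EndBy G turn i B k`: starting from burned set `B` at round index `i`
(the player selecting in round `i` is Burner iff `turn i = true`; Burner's selections are
quantified existentially, Staller's universally), Burner can force the game to end
within `k` further rounds. -/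
def EndBy {V : Type*} [Fintype V] [DecidableEq V] (G : SimpleGraph V) (turn : ℕ → Bool) :
    ℕ → Finset V → ℕ → Prop
  | _, B, 0 => B = Finset.univ
  | i, B, k + 1 => B = Finset.univ ∨
      spread G B = Finset.univ ∨
      (if turn i then ∃ v ∉ spread G B, EndBy G turn (i + 1) (insert v (spread G B)) k
       else ∀ v ∉ spread G B, EndBy G turn (i + 1) (insert v (spread G B)) k)

/-- Game burning number relative to a preburned set `S` (Burner starts). -/
noncomputable def bgRel {V : Type*} [Fintype V] [DecidableEq V] (G : SimpleGraph V) (S : Finset V) : ℕ :=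
  sInf {k | EndBy G (fun i => i % 2 == 0) 0 S k}

/-- The game burning number (Burner starts). -/
noncomputable def bg {V : Type*} [Fintype V] [DecidableEq V] (G : SimpleGraph V) : ℕ := bgRel G ∅

/-- The Staller-start game burning number. -/
noncomputable def bg' {V : Type*} [Fintype V] [DecidableEq V] (G : SimpleGraph V) : ℕ :=
  sInf {k | EndBy G (fun i => i % 2 == 1) 0 ∅ k}

/-- The burning number: only Burner plays. -/
noncomputable def burn {V : Type*} [Fintype V] [DecidableEq V] (G : SimpleGraph V) : ℕ :=
  sInf {k | EndBy G (fun _ => true) 0 ∅ k}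

/-- The cooling number: only Staller plays. -/
noncomputable def cool {V : Type*} [Fintype V] [DecidableEq V] (G : SimpleGraph V) : ℕ :=
  sInf {k | EndBy G (fun _ => false) 0 ∅ k}

/-- Every vertex has eccentricity at most two in `G` or in its complement. -/
theorem dist_le_two_or_compl {V : Type*} (G : SimpleGraph V) (v : V) :
    (∀ x, v = x ∨ G.Adj v x ∨ ∃ w, G.Adj v w ∧ G.Adj w x) ∨
      ∀ x, v = x ∨ Gᶜ.Adj v x ∨ ∃ w, Gᶜ.Adj v w ∧ Gᶜ.Adj w x := by
  by_contra! ⟨⟨w, hvw, hadj, hw⟩, x, hvx, hx, hx'⟩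
  simp only [SimpleGraph.compl_adj, not_and, not_not] at hx hx'
  have hwx : w ≠ x := fun h => hadj (h ▸ hx hvx)
  exact hw x (hx hvx) (hx' w ⟨hvw, hadj⟩ hwx).symm

section

variable {V : Type*} [Fintype V] [DecidableEq V]

theorem mem_spread {G : SimpleGraph V} {B : Finset V} {v : V} :
    v ∈ spread G B ↔ v ∈ B ∨ ∃ u ∈ B, G.Adj u v := by
  simp [spread]

theorem subset_spread (G : SimpleGraph V) (B : Finset V) : B ⊆ spread G B :=
  fun _ hv => mem_spread.2 (Or.inl hv)

@[simp]
theorem spread_empty (G : SimpleGraph V) : spread G ∅ = ∅ := by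
  ext v
  simp [mem_spread]

theorem endBy_of_card_le (G : SimpleGraph V) (turn : ℕ → Bool) (k : ℕ) :
    ∀ (i : ℕ) (B : Finset V), Fintype.card V ≤ B.card + k → EndBy G turn i B k := by
  induction k with
  | zero =>
    intro i B h
    exact (Finset.card_eq_iff_eq_univ B).1 (le_antisymm (Finset.card_le_univ B) h)
  | succ k ih =>
    intro i B h
    have step : ∀ v ∉ spread G B, EndBy G turn (i + 1) (insert v (spread G B)) k := by
      intro v hv
      apply ih
      rw [Finset.card_insert_of_notMem hv]
      have := Finset.card_le_card (subset_spread G B)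
      omega
    by_cases hs : spread G B = Finset.univ
    · exact Or.inr (Or.inl hs)
    · refine Or.inr (Or.inr ?_)
      split_ifs
      · obtain ⟨v, hv⟩ : ∃ v, v ∉ spread G B := by
          simpa [Finset.eq_univ_iff_forall] using hs
        exact ⟨v, hv, step v hv⟩
      · exact step

theorem bg_le_of_endBy {G : SimpleGraph V} {k : ℕ}
    (h : EndBy G (fun i => i % 2 == 0) 0 ∅ k) : bg G ≤ k :=
  Nat.sInf_le h

theorem endBy_bg (G : SimpleGraph V) : EndBy G (fun i => i % 2 == 0) 0 ∅ (bg G) :=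
  Nat.sInf_mem (s := {k | EndBy G (fun i => i % 2 == 0) 0 ∅ k})
    ⟨Fintype.card V, endBy_of_card_le G _ _ _ _ (by simp)⟩

theorem bg_le_card (G : SimpleGraph V) : bg G ≤ Fintype.card V :=
  bg_le_of_endBy (endBy_of_card_le G _ _ _ _ (by simp))

theorem two_le_bg (G : SimpleGraph V) (hn : 2 ≤ Fintype.card V) : 2 ≤ bg G := by
  have hne : (∅ : Finset V) ≠ Finset.univ := by
    intro h
    have := congrArg Finset.card h
    rw [Finset.card_empty, Finset.card_univ] at this
    omega
  have h := endBy_bg G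
  by_contra! hlt
  interval_cases hb : bg G
  · exact hne h
  · rcases h with h | h | h
    · exact hne h
    · exact hne (by simpa using h)
    · obtain ⟨v, -, hv⟩ : ∃ v ∉ spread G ∅, insert v (spread G ∅) = Finset.univ := by
        simpa [EndBy] using h
      have := congrArg Finset.card hv
      simp at this
      omega

/-- After Burner opens with `v`, it suffices to handle the position Staller faces. -/
theorem bg_le_add_two {G : SimpleGraph V} {k : ℕ} (v : V)
    (h : spread G {v} = Finset.univ ∨ ∀ w ∉ spread G {v},
      EndBy G (fun i => i % 2 == 0) 2 (insert w (spread G {v})) k) : bg G ≤ k + 2 := by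
  apply bg_le_of_endBy
  refine Or.inr (Or.inr ?_)
  rw [if_pos (by rfl)]
  refine ⟨v, by simp, Or.inr ?_⟩
  rw [spread_empty, insert_empty_eq, if_neg (by simp)]
  exact h

theorem bg_top_le_two [Nonempty V] : bg (⊤ : SimpleGraph V) ≤ 2 := by
  obtain ⟨v⟩ := ‹Nonempty V›
  refine bg_le_add_two (k := 0) v (Or.inl ?_)
  ext w
  simp [mem_spread, eq_comm, em]

theorem bg_le_three {G : SimpleGraph V} (v : V)
    (h : ∀ x, v = x ∨ G.Adj v x ∨ ∃ w, G.Adj v w ∧ G.Adj w x) : bg G ≤ 3 := by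
  refine bg_le_add_two (k := 1) v (Or.inr fun w _ => Or.inr (Or.inl ?_))
  ext x
  simp only [mem_spread, Finset.mem_insert, Finset.mem_singleton, Finset.mem_univ, iff_true]
  rcases h x with rfl | hx | ⟨y, hy, hyx⟩
  · simp
  · exact Or.inl (Or.inr (Or.inr ⟨v, rfl, hx⟩))
  · exact Or.inr ⟨y, Or.inr (Or.inr ⟨v, rfl, hy⟩), hyx⟩

theorem bg_add_one_le_card {G : SimpleGraph V} {u v : V} (huv : G.Adj u v)
    (hn : 3 ≤ Fintype.card V) : bg G + 1 ≤ Fintype.card V := by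
  obtain ⟨m, hm⟩ := Nat.exists_eq_add_of_le hn
  have : bg G ≤ m + 2 := by
    refine bg_le_add_two u (Or.inr fun w hw => endBy_of_card_le G _ _ _ _ ?_)
    rw [Finset.card_insert_of_notMem hw]
    have hsub : ({u, v} : Finset V) ⊆ spread G {u} := by
      intro x hx
      simp only [Finset.mem_insert, Finset.mem_singleton] at hx
      rcases hx with rfl | rfl <;> simp [mem_spread, huv]
    have := Finset.card_le_card hsub
    rw [Finset.card_pair huv.ne] at this
    omega
  omega

theorem bg_add_bg_compl_le {G : SimpleGraph V} (hn : 2 ≤ Fintype.card V) (v : V)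
    (h : ∀ x, v = x ∨ G.Adj v x ∨ ∃ w, G.Adj v w ∧ G.Adj w x) :
    bg G + bg Gᶜ ≤ Fintype.card V + 2 := by
  have hG := bg_le_card G
  have hGc := bg_le_card Gᶜ
  by_cases h2 : Fintype.card V = 2
  · omega
  by_cases hbot : Gᶜ = ⊥
  · have : Nonempty V := ⟨v⟩
    obtain rfl : G = ⊤ := compl_eq_bot.1 hbot
    have := bg_top_le_two (V := V)
    omega
  · obtain ⟨a, b, hab⟩ := SimpleGraph.ne_bot_iff_exists_adj.1 hbot
    have h3 := bg_le_three v h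
    have := bg_add_one_le_card hab (by omega)
    omega

end

theorem stmt12 {V : Type*} [Fintype V] [DecidableEq V] (G : SimpleGraph V)
    (hn : 2 ≤ Fintype.card V) :
    4 ≤ bg G + bg Gᶜ ∧ bg G + bg Gᶜ ≤ Fintype.card V + 2 := by
  refine ⟨add_le_add (two_le_bg G hn) (two_le_bg Gᶜ hn), ?_⟩
  obtain ⟨v⟩ : Nonempty V := Fintype.card_pos_iff.1 (by omega)
  rcases dist_le_two_or_compl G v with h | h
  · exact bg_add_bg_compl_le hn v h
  · have := bg_add_bg_compl_le hn v h
    rwa [compl_compl, add_comm] at this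

end BurningGame
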